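/- For all integers m > k > 1 and every real number q with 0 < q < 1, Black's rule satisfies the (q,k,m)-majority criterion if and only if q ≥ (2m−k−1)/(2m). -/

import Mathlib

open Finset
open scoped Classical

noncomputable section

/-- A preference profile: each of the `n` voters has a ranking of the `m`
candidates, given as a bijection sending each candidate to its rank
(rank `0` is the best).  Voter `i` prefers `a` to `b` iff `P i a < P i b`. -/
abbrev Profile (m n : ℕ) := Fin n → (Fin m ≃ Fin m)

namespace Voting

variable {m n : ℕ}

/-- `h(a,b)`: the number of voters who prefer candidate `a` to candidate `b`. -/
def pairs (P : Profile m n) (a b : Fin m) : ℕ :=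
  (Finset.univ.filter fun i => P i a < P i b).card

/-- `n_1(a)`: the number of voters who rank candidate `a` first. -/
def firstCount (P : Profile m n) (a : Fin m) : ℕ :=
  (Finset.univ.filter fun i => ∀ b, b ≠ a → P i a < P i b).card

/-- `n_m(a)`: the number of voters who rank candidate `a` last. -/
def lastCount (P : Profile m n) (a : Fin m) : ℕ :=
  (Finset.univ.filter fun i => ∀ b, b ≠ a → P i b < P i a).card

/-- The number of voters who give the set `B` the top `|B|` positions. -/
def topSupporters (P : Profile m n) (B : Finset (Fin m)) : ℕ :=
  (Finset.univ.filter fun i => ∀ a ∈ B, ∀ b ∉ B, P i a < P i b).card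

/-- The `(q,k,m)`-majority criterion for a voting rule with `m` candidates:
for every number of voters `n ≥ 1`, every profile, and every `k`-element set `B`
of candidates such that strictly more than `q·n` voters give `B` the top `k`
positions, every winner belongs to `B`. -/
def MajorityCriterion (m k : ℕ) (q : ℝ)
    (rule : (n : ℕ) → Profile m n → Finset (Fin m)) : Prop :=
  ∀ n : ℕ, 1 ≤ n → ∀ P : Profile m n, ∀ B : Finset (Fin m),
    B.card = k → q * (n : ℝ) < (topSupporters P B : ℝ) → rule n P ⊆ B

/-- `a` is a Condorcet winner: `h(a,b) > n/2` for every `b ≠ a`. -/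
def CondorcetWinner (P : Profile m n) (a : Fin m) : Prop :=
  ∀ b, b ≠ a → (n : ℝ) / 2 < (pairs P a b : ℝ)

/-- The Borda score `Bo(a) = Σ_{b ≠ a} h(a,b)`. -/
def bordaScore (P : Profile m n) (a : Fin m) : ℕ :=
  ∑ b ∈ Finset.univ.erase a, pairs P a b

/-- Black's rule: the Condorcet winner if one exists, otherwise the candidates
with the highest Borda score. -/
def blackWinners (P : Profile m n) : Finset (Fin m) :=
  if ∃ a, CondorcetWinner P a then Finset.univ.filter fun a => CondorcetWinner P a
  else Finset.univ.filter fun a => ∀ b, bordaScore P b ≤ bordaScore P a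

theorem two_mul_sum_add_card_le (S : Finset ℕ) :
    ∀ M : ℕ, (∀ x ∈ S, x < M) → 2 * ∑ x ∈ S, x + #S * (#S + 1) ≤ 2 * #S * M := by
  induction S using Finset.induction_on_max with
  | empty => simp
  | insert x S hx ih =>
    intro M hM
    have hxS : x ∉ S := fun h => lt_irrefl _ (hx x h)
    have hS := ih x hx
    have hxM : x + 1 ≤ M := hM x (mem_insert_self _ _)
    rw [sum_insert hxS, card_insert_of_notMem hxS]
    nlinarith [Nat.mul_le_mul_left (2 * (#S + 1)) hxM]

theorem pairs_eq_sum (P : Profile m n) (a b : Fin m) :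
    pairs P a b = ∑ i, if P i a < P i b then 1 else 0 := by
  rw [pairs, card_filter]

theorem pairs_add_pairs (P : Profile m n) {a b : Fin m} (hab : a ≠ b) :
    pairs P a b + pairs P b a = n := by
  rw [pairs_eq_sum, pairs_eq_sum, ← sum_add_distrib]
  have h : ∀ i, ((if P i a < P i b then 1 else 0) + if P i b < P i a then 1 else 0) = 1 := by
    intro i
    have hne : P i a ≠ P i b := (P i).injective.ne hab
    rcases lt_or_gt_of_ne hne with h | h <;> simp [h, h.not_gt]
  simp [h]

theorem bordaScore_add_sum_rank (P : Profile m n) (a : Fin m) :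
    bordaScore P a + ∑ i, (P i a : ℕ) = n * (m - 1) := by
  have h : ∀ i, (∑ b ∈ univ.erase a, if P i a < P i b then 1 else 0) + (P i a : ℕ) = m - 1 := by
    intro i
    have hs : (∑ b ∈ univ.erase a, if P i a < P i b then 1 else 0) = #(Ioi (P i a)) := by
      rw [sum_erase _ (by simp), Equiv.sum_comp (P i) (fun c => if P i a < c then 1 else 0),
        ← card_filter]
      congr 1
      ext c
      simp
    have := (P i a).isLt
    rw [hs, Fin.card_Ioi]
    omega
  simp only [bordaScore, pairs_eq_sum]
  rw [sum_comm, ← sum_add_distrib, sum_congr rfl fun i _ => h i]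
  simp

theorem bordaScore_le_iff (P : Profile m n) (a b : Fin m) :
    bordaScore P b ≤ bordaScore P a ↔ ∑ i, (P i a : ℕ) ≤ ∑ i, (P i b : ℕ) := by
  have ha := bordaScore_add_sum_rank P a
  have hb := bordaScore_add_sum_rank P b
  omega

theorem topSupporters_le_pairs (P : Profile m n) {B : Finset (Fin m)} {a b : Fin m}
    (hb : b ∈ B) (ha : a ∉ B) : topSupporters P B ≤ pairs P b a :=
  card_le_card fun i hi => by
    simp only [mem_filter, mem_univ, true_and] at hi ⊢
    exact hi b hb a ha

/-- A candidate outside `B` whose Borda score is at least that of every member of `B` bounds the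
number of voters who put `B` on top. -/
theorem topSupporters_le_of_bordaScore_le (P : Profile m n) {B : Finset (Fin m)} (hB : B.Nonempty)
    {a : Fin m} (ha : a ∉ B) (hBo : ∀ b ∈ B, bordaScore P b ≤ bordaScore P a) :
    2 * m * topSupporters P B + (#B + 1) * n ≤ 2 * m * n := by
  set supp : Fin n → Prop := fun i => ∀ a ∈ B, ∀ b ∉ B, P i a < P i b
  have hvoter : ∀ i, 2 * ∑ b ∈ B, (P i b : ℕ) + #B * (#B + 1)
      + 2 * #B * m * (if supp i then 1 else 0) ≤ 2 * #B * (P i a : ℕ) + 2 * #B * m := by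
    intro i
    have hinj : Function.Injective fun b => (P i b : ℕ) :=
      Fin.val_injective.comp (P i).injective
    have key := two_mul_sum_add_card_le (B.image fun b => (P i b : ℕ))
    rw [sum_image hinj.injOn, card_image_of_injective _ hinj] at key
    split_ifs with hs
    · have := key (P i a) (by
        simp only [mem_image, forall_exists_index, and_imp]
        rintro _ b hb rfl
        exact hs b hb a ha)
      omega
    · have := key m (by
        simp only [mem_image, forall_exists_index, and_imp]
        rintro _ b _ rfl
        exact (P i b).isLt)
      omega
  have htotal := sum_le_sum fun i (_ : i ∈ univ) => hvoter i
  simp only [sum_add_distrib, ← mul_sum, sum_const, card_univ, Fintype.card_fin, smul_eq_mul]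
    at htotal
  rw [← card_filter, sum_comm] at htotal
  have hle : #B * ∑ i, (P i a : ℕ) ≤ ∑ b ∈ B, ∑ i, (P i b : ℕ) := by
    rw [← smul_eq_mul]
    exact card_nsmul_le_sum _ _ _ fun b hb => (bordaScore_le_iff P a b).1 (hBo b hb)
  have hpos : 0 < #B := hB.card_pos
  change _ + 2 * #B * m * topSupporters P B ≤ _ at htotal
  refine Nat.le_of_mul_le_mul_left ?_ hpos
  nlinarith

theorem blackWinners_subset (P : Profile m n) {B : Finset (Fin m)} (hB : B.Nonempty)
    (hmaj : n < 2 * topSupporters P B)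
    (hborda : 2 * m * n < 2 * m * topSupporters P B + (#B + 1) * n) :
    blackWinners P ⊆ B := by
  intro a ha
  by_contra haB
  unfold blackWinners at ha
  split_ifs at ha
  · obtain ⟨b, hb⟩ := hB
    have hab : a ≠ b := fun h => haB (h ▸ hb)
    have hwin := (mem_filter.1 ha).2 b hab.symm
    have hsum := pairs_add_pairs P hab
    have hle := topSupporters_le_pairs P hb haB
    rw [div_lt_iff₀ two_pos] at hwin
    norm_cast at hwin
    omega
  · have := topSupporters_le_of_bordaScore_le P hB haB fun b _ => (mem_filter.1 ha).2 b
    omega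

theorem not_blackWinners_subset (P : Profile m n) {B : Finset (Fin m)} {a : Fin m} (ha : a ∉ B)
    (hB : ∀ b ∈ B, ¬ CondorcetWinner P b) (hBo : ∀ b ∈ B, bordaScore P b ≤ bordaScore P a) :
    ¬ blackWinners P ⊆ B := by
  intro hsub
  unfold blackWinners at hsub
  split_ifs at hsub with hc
  · obtain ⟨c, hc⟩ := hc
    exact hB c (hsub (by simpa using hc)) hc
  · obtain ⟨w, -, hw⟩ := exists_max_image univ (bordaScore P) ⟨a, mem_univ a⟩
    have hwB : w ∈ B := hsub (by simpa using hw)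
    exact ha (hsub (mem_filter.2 ⟨mem_univ _, fun c =>
      (hw c (mem_univ c)).trans (hBo w hwB)⟩))

/-- The ranking that reverses the order of the candidates `0, …, k - 1` and fixes the others. -/
def reverseTop (m k : ℕ) (hmk : k < m) : Fin m ≃ Fin m where
  toFun x := if (x : ℕ) < k then ⟨k - 1 - x, by omega⟩ else x
  invFun x := if (x : ℕ) < k then ⟨k - 1 - x, by omega⟩ else x
  left_inv x := by
    ext
    dsimp only
    split_ifs <;> simp_all <;> omega
  right_inv x := by
    ext
    dsimp only
    split_ifs <;> simp_all <;> omega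

theorem reverseTop_val (m k : ℕ) (hmk : k < m) (x : Fin m) :
    (reverseTop m k hmk x : ℕ) = if (x : ℕ) < k then k - 1 - (x : ℕ) else x := by
  change ((if (x : ℕ) < k then ⟨k - 1 - x, _⟩ else x : Fin m) : ℕ) = _
  split_ifs <;> rfl

/-- The ranking that moves the candidates `0, …, k - 1` to the bottom positions. -/
def moveToBottom (m k : ℕ) (hmk : k < m) : Fin m ≃ Fin m where
  toFun x := if h : (x : ℕ) < k then ⟨m - k + x, by omega⟩ else ⟨x - k, by omega⟩
  invFun y := if h : (y : ℕ) < m - k then ⟨y + k, by omega⟩ else ⟨y - (m - k), by omega⟩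
  left_inv x := by
    ext
    by_cases hx : (x : ℕ) < k
    · simp [hx]
    · have : (x : ℕ) - k < m - k := by omega
      simp only [hx, dif_neg, not_false_eq_true, this, dif_pos]
      omega
  right_inv y := by
    ext
    by_cases hy : (y : ℕ) < m - k
    · simp [hy]
    · have : (y : ℕ) - (m - k) < k := by omega
      simp only [hy, dif_neg, not_false_eq_true, this, dif_pos]
      omega

theorem moveToBottom_val (m k : ℕ) (hmk : k < m) (x : Fin m) :
    (moveToBottom m k hmk x : ℕ) = if (x : ℕ) < k then m - k + x else (x : ℕ) - k := by
  change ((if h : (x : ℕ) < k then ⟨m - k + x, _⟩ else ⟨x - k, _⟩ : Fin m) : ℕ) = _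
  split_ifs <;> rfl

/-- The voters of the extremal profile: those in the left summand put `0, …, k - 1` on top, the
others at the bottom, and the Boolean tells whether these candidates are listed in reverse. -/
abbrev Voter (m k : ℕ) := (Fin (2 * m - k - 1) ⊕ Fin (k + 1)) × Bool

/-- The ranking of each voter of the extremal profile. -/
def voterRanking (m k : ℕ) (hmk : k < m) (v : Voter m k) : Fin m ≃ Fin m :=
  (if v.2 then reverseTop m k hmk else Equiv.refl _).trans
    (v.1.elim (fun _ => Equiv.refl _) (fun _ => moveToBottom m k hmk))

theorem voterRanking_val (m k : ℕ) (hmk : k < m) (v : Voter m k) (x : Fin m) :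
    (voterRanking m k hmk v x : ℕ) =
      if (x : ℕ) < k then
        (if v.2 then k - 1 - x else (x : ℕ)) + v.1.elim (fun _ => 0) (fun _ => m - k)
      else x - v.1.elim (fun _ => 0) (fun _ => k) := by
  obtain ⟨s | s, _ | _⟩ := v <;> by_cases hx : (x : ℕ) < k
  all_goals
    simp [voterRanking, reverseTop_val, moveToBottom_val, hx]
    try split_ifs
    all_goals omega

theorem card_voter (m k : ℕ) (hmk : k < m) : Fintype.card (Voter m k) = 4 * m := by
  simp only [Fintype.card_prod, Fintype.card_sum, Fintype.card_fin, Fintype.card_bool]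
  omega

/-- A numbering of the voters of the extremal profile. -/
def voterEquiv (m k : ℕ) (hmk : k < m) : Fin (4 * m) ≃ Voter m k :=
  (Fintype.equivFinOfCardEq (card_voter m k hmk)).symm

/-- A profile in which the candidates `0, …, k` have the same Borda score and no candidate below `k`
is a Condorcet winner. -/
def extremalProfile (m k : ℕ) (hmk : k < m) : Profile m (4 * m) :=
  fun i => voterRanking m k hmk (voterEquiv m k hmk i)

theorem sum_extremalProfile (m k : ℕ) (hmk : k < m) (f : (Fin m ≃ Fin m) → ℕ) :
    ∑ i, f (extremalProfile m k hmk i) = ∑ v, f (voterRanking m k hmk v) :=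
  Equiv.sum_comp (voterEquiv m k hmk) fun v => f (voterRanking m k hmk v)

/-- The candidates `0, …, k - 1`. -/
def firstCandidates (m k : ℕ) : Finset (Fin m) := univ.filter fun x => (x : ℕ) < k

theorem card_firstCandidates (m k : ℕ) (hmk : k < m) : #(firstCandidates m k) = k := by
  rw [firstCandidates, Fin.card_filter_val_lt]
  omega

theorem le_topSupporters_extremalProfile (m k : ℕ) (hmk : k < m) :
    2 * (2 * m - k - 1) ≤ topSupporters (extremalProfile m k hmk) (firstCandidates m k) := by
  rw [topSupporters, card_filter, sum_extremalProfile m k hmk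
    (fun r => if ∀ a ∈ firstCandidates m k, ∀ b ∉ firstCandidates m k, r a < r b then 1 else 0),
    Fintype.sum_prod_type, Fintype.sum_sum_type]
  refine le_add_right ?_
  have h : ∀ s b, ∀ x ∈ firstCandidates m k, ∀ y ∉ firstCandidates m k,
      voterRanking m k hmk (Sum.inl s, b) x < voterRanking m k hmk (Sum.inl s, b) y := by
    intro s b x hx y hy
    simp only [firstCandidates, mem_filter, mem_univ, true_and] at hx hy
    rw [Fin.lt_def, voterRanking_val, voterRanking_val, if_pos hx, if_neg hy]
    cases b <;> simp <;> omega
  rw [sum_congr rfl fun s _ => sum_congr rfl fun b _ => if_pos (h s b)]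
  simp [mul_comm]

theorem sum_rank_extremalProfile (m k : ℕ) (hmk : k < m) (b : Fin m) (hb : (b : ℕ) ≤ k) :
    ∑ i, (extremalProfile m k hmk i b : ℕ) = 2 * k * (2 * m - k - 1) := by
  rw [sum_extremalProfile m k hmk (fun r => (r b : ℕ)), Fintype.sum_prod_type,
    Fintype.sum_sum_type]
  simp only [voterRanking_val, Fintype.sum_bool, Sum.elim_inl, Sum.elim_inr, if_true,
    Bool.false_eq_true, if_false, sum_const, card_univ, Fintype.card_fin, smul_eq_mul]
  rcases hb.lt_or_eq with hb | hb
  · simp only [hb, if_true]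
    have htop : k - 1 - (b : ℕ) + 0 + (b + 0) = k - 1 := by omega
    have hbot : k - 1 - (b : ℕ) + (m - k) + (b + (m - k)) = 2 * m - k - 1 := by omega
    have hk : k - 1 + (k + 1) = 2 * k := by omega
    rw [htop, hbot, ← hk]
    ring
  · simp [hb]
    ring

theorem not_condorcetWinner_extremalProfile (m k : ℕ) (hk : 1 < k) (hmk : k < m) (b : Fin m)
    (hb : (b : ℕ) < k) : ¬ CondorcetWinner (extremalProfile m k hmk) b := by
  intro hwin
  obtain ⟨c, hck, hcb⟩ : ∃ c : Fin m, (c : ℕ) < k ∧ c ≠ b := by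
    by_cases h : (b : ℕ) = 0
    · exact ⟨⟨1, by omega⟩, hk, fun h' => by simp [← h'] at h⟩
    · exact ⟨⟨0, by omega⟩, by simp only; omega, fun h' => by simp [← h'] at h⟩
  have hne : (c : ℕ) ≠ b := Fin.val_injective.ne hcb
  have hpairs : pairs (extremalProfile m k hmk) b c = 2 * m := by
    rw [pairs_eq_sum, sum_extremalProfile m k hmk (fun r => if r b < r c then 1 else 0),
      Fintype.sum_prod_type]
    have h : ∀ s, (∑ t, if voterRanking m k hmk (s, t) b < voterRanking m k hmk (s, t) c
        then 1 else 0) = 1 := by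
      intro s
      simp only [Fin.lt_def, voterRanking_val, Fintype.sum_bool, if_pos hb, if_pos hck,
        add_lt_add_iff_right, if_true, Bool.false_eq_true, if_false]
      split_ifs <;> omega
    simp only [h, sum_const, card_univ, Fintype.card_sum, Fintype.card_fin, smul_eq_mul]
    omega
  have h := hwin c hcb
  rw [hpairs] at h
  push_cast at h
  linarith

/-- For all integers `m > k > 1` and every real `q` with `0 < q < 1`, Black's
rule satisfies the `(q,k,m)`-majority criterion iff `q ≥ (2m−k−1)/(2m)`. -/
theorem black_qkm_majority (m k : ℕ) (hk : 1 < k) (hmk : k < m)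
    (q : ℝ) (hq0 : 0 < q) (hq1 : q < 1) :
    MajorityCriterion m k q (fun n P => blackWinners P) ↔
      (2 * (m : ℝ) - (k : ℝ) - 1) / (2 * (m : ℝ)) ≤ q := by
  have hm : (0 : ℝ) < 2 * m := by
    have : 0 < m := by omega
    positivity
  have hkm : (k : ℝ) + 1 ≤ m := by exact_mod_cast hmk
  constructor
  · intro hcrit
    by_contra! hq
    refine not_blackWinners_subset (extremalProfile m k hmk) (B := firstCandidates m k)
      (a := ⟨k, hmk⟩) (by simp [firstCandidates])
      (fun b hb => not_condorcetWinner_extremalProfile m k hk hmk b (mem_filter.1 hb).2)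
      (fun b hb => ?_)
      (hcrit _ (by omega) _ _ (card_firstCandidates m k hmk) ?_)
    · rw [bordaScore_le_iff, sum_rank_extremalProfile m k hmk _ le_rfl,
        sum_rank_extremalProfile m k hmk b (mem_filter.1 hb).2.le]
    · have hle := le_topSupporters_extremalProfile m k hmk
      have hle' : 4 * m ≤ topSupporters (extremalProfile m k hmk) (firstCandidates m k)
          + 2 * k + 2 := by omega
      have hle'' : (4 * m : ℝ) ≤ topSupporters (extremalProfile m k hmk) (firstCandidates m k)
          + 2 * k + 2 := by exact_mod_cast hle'
      rw [lt_div_iff₀ hm] at hq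
      push_cast
      linarith
  · intro hq n hn P B hB ht
    have hn' : (0 : ℝ) < n := by exact_mod_cast hn
    rw [div_le_iff₀ hm] at hq
    have hborda : (2 * m - k - 1 : ℝ) * n < topSupporters P B * (2 * m) := by
      nlinarith [mul_le_mul_of_nonneg_right hq hn'.le, mul_lt_mul_of_pos_right ht hm]
    refine blackWinners_subset P (card_pos.1 (by omega)) ?_ ?_
    · have : (n : ℝ) < 2 * topSupporters P B := by
        nlinarith
      exact_mod_cast this
    · rw [hB]
      have : (2 * m * n : ℝ) < 2 * m * topSupporters P B + (k + 1) * n := by linarith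
      exact_mod_cast this

end Voting
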